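/- The Belavin R-matrix is unitary: for generic ξ ∈ ℂ one has R₁₂(z) · R₂₁(z^{−1}) = Id on ℂ^N ⊗ ℂ^N, where z = e^{iπξ}, z^{−1} = e^{−iπξ}, R₂₁(w) = P · R(w) · P, and P is the flip operator P(u ⊗ v) = v ⊗ u. -/

import Mathlib

open Complex Matrix Kronecker

noncomputable section

/-- `eπ x = exp(iπx)`; the variables `z, q, p` of the paper are `eπ ξ, eπ ζ, eπ (2τ)`. -/
def eπ (x : ℂ) : ℂ := Complex.exp (Real.pi * Complex.I * x)

/-- Jacobi theta function with characteristics `ϑ[γ₁,γ₂](u,τ)`. -/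
def jTheta (γ₁ γ₂ : ℝ) (u τ : ℂ) : ℂ :=
  ∑' m : ℤ, Complex.exp (Real.pi * Complex.I * ((m : ℂ) + (γ₁ : ℂ)) ^ 2 * τ +
    2 * Real.pi * Complex.I * ((m : ℂ) + (γ₁ : ℂ)) * (u + (γ₂ : ℂ)))

/-- single infinite Pochhammer symbol `(x;s)_∞`. -/
def poch1 (x s : ℂ) : ℂ := ∏' n : ℕ, (1 - x * s ^ n)

/-- double infinite Pochhammer symbol `(x;p₁,p₂)_∞`. -/
def poch2 (x p₁ p₂ : ℂ) : ℂ := ∏' n : ℕ × ℕ, (1 - x * p₁ ^ n.1 * p₂ ^ n.2)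

/-- Jacobi `Θ_s(x)` function. -/
def ThetaF (s x : ℂ) : ℂ := poch1 x s * poch1 (s * x⁻¹) s * poch1 s s

/-- numerator of `1/κ(z²)`, with `z = eπ ξ`, `q = eπ ζ`, `p = eπ (2τ)`. -/
def kappaNum (N : ℕ) (ξ ζ τ : ℂ) : ℂ :=
  poch2 (eπ (2 * N * ζ - 2 * ξ)) (eπ (2 * τ)) (eπ (2 * N * ζ)) *
  poch2 (eπ (2 * ζ + 2 * ξ)) (eπ (2 * τ)) (eπ (2 * N * ζ)) *
  poch2 (eπ (2 * τ - 2 * ξ)) (eπ (2 * τ)) (eπ (2 * N * ζ)) *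
  poch2 (eπ (2 * τ + (2 * N - 2) * ζ + 2 * ξ)) (eπ (2 * τ)) (eπ (2 * N * ζ))

/-- denominator of `1/κ(z²)`: the numerator with `ξ → -ξ`. -/
def kappaDen (N : ℕ) (ξ ζ τ : ℂ) : ℂ := kappaNum N (-ξ) ζ τ

/-- the diagonal matrix `g^{1/2}` with entries `e^{iπj/N}`, `1 ≤ j ≤ N`. -/
def gHalf (N : ℕ) : Matrix (Fin N) (Fin N) ℂ :=
  Matrix.diagonal fun j => eπ ((((j : ℕ) : ℂ) + 1) / N)

/-- the diagonal matrix `g` with entries `ω^j = e^{2iπj/N}`, `1 ≤ j ≤ N`. -/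
def gMat (N : ℕ) : Matrix (Fin N) (Fin N) ℂ :=
  Matrix.diagonal fun j => eπ (2 * (((j : ℕ) : ℂ) + 1) / N)

/-- the shift matrix `h`, `h_{jl} = δ_{j+1,l}` (mod `N`). -/
def hMat (N : ℕ) : Matrix (Fin N) (Fin N) ℂ :=
  Matrix.of fun j l => if (l : ℕ) = ((j : ℕ) + 1) % N then 1 else 0

/-- `I_{(α₁,α₂)} = g^{α₂} h^{α₁}`. -/
def Imat (N : ℕ) (α : Fin N × Fin N) : Matrix (Fin N) (Fin N) ℂ :=
  gMat N ^ (α.2 : ℕ) * hMat N ^ (α.1 : ℕ)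

/-- the coefficient `W_{(α₁,α₂)}(ξ,ζ,τ)`. -/
def Wcoef (N : ℕ) (α : Fin N × Fin N) (ξ ζ τ : ℂ) : ℂ :=
  jTheta (1/2 + (α.1 : ℕ) / N) (1/2 + (α.2 : ℕ) / N) (ξ + ζ / N) τ /
    (N * jTheta (1/2 + (α.1 : ℕ) / N) (1/2 + (α.2 : ℕ) / N) (ζ / N) τ)

/-- the matrix `𝒵(z)`, `z = eπ ξ`. -/
def Zmat (N : ℕ) (ξ ζ τ : ℂ) : Matrix (Fin N × Fin N) (Fin N × Fin N) ℂ :=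
  (eπ (ξ * (2 / N - 2)) * (kappaNum N ξ ζ τ / kappaDen N ξ ζ τ) *
      jTheta (1/2) (1/2) ζ τ / jTheta (1/2) (1/2) (ξ + ζ) τ) •
    ∑ α : Fin N × Fin N, Wcoef N α ξ ζ τ • (Imat N α ⊗ₖ (Imat N α)⁻¹)

/-- the Belavin R-matrix `R(z)`, as a function of `ξ` with `z = eπ ξ`. -/
def Rmat (N : ℕ) (ξ ζ τ : ℂ) : Matrix (Fin N × Fin N) (Fin N × Fin N) ℂ :=
  (gHalf N ⊗ₖ gHalf N) * Zmat N ξ ζ τ * (gHalf N ⊗ₖ gHalf N)⁻¹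

/-- genericity: every theta-function value and κ-value appearing in a denominator is nonzero. -/
def Rgeneric (N : ℕ) (ξ ζ τ : ℂ) : Prop :=
  jTheta (1/2) (1/2) (ξ + ζ) τ ≠ 0 ∧
  (∀ α : Fin N × Fin N,
    jTheta (1/2 + (α.1 : ℕ) / N) (1/2 + (α.2 : ℕ) / N) (ζ / N) τ ≠ 0) ∧
  kappaDen N ξ ζ τ ≠ 0

/-- the flip (permutation) operator `P` on `ℂ^N ⊗ ℂ^N`. -/
def Pflip (N : ℕ) : Matrix (Fin N × Fin N) (Fin N × Fin N) ℂ :=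
  Matrix.of fun a b => if a.1 = b.2 ∧ a.2 = b.1 then 1 else 0

/-- partial transposition in the second tensor factor. -/
def pt2 {N : ℕ} (M : Matrix (Fin N × Fin N) (Fin N × Fin N) ℂ) :
    Matrix (Fin N × Fin N) (Fin N × Fin N) ℂ :=
  Matrix.of fun a b => M (a.1, b.2) (b.1, a.2)

/-- `τ_N` evaluated at `eπ u` (all fractional powers via exponentials). -/
def tauNe (N : ℕ) (ζ u : ℂ) : ℂ :=
  eπ (u * (2 / N - 2)) * ThetaF (eπ (2 * N * ζ)) (eπ (ζ + 2 * u)) /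
    ThetaF (eπ (2 * N * ζ)) (eπ (ζ - 2 * u))

/-- the normalized Belavin R-matrix `R̂(z) = τ_N(q^{1/2}z⁻¹) R(z)`, as a function of `ξ`. -/
def Rhat (N : ℕ) (ξ ζ τ : ℂ) : Matrix (Fin N × Fin N) (Fin N × Fin N) ℂ :=
  tauNe N ζ (ζ / 2 - ξ) • Rmat N ξ ζ τ


lemma jTheta_eq (γ₁ γ₂ : ℝ) (u τ : ℂ) : jTheta γ₁ γ₂ u τ =
    cexp (Real.pi * I * (γ₁:ℂ)^2 * τ + 2 * Real.pi * I * γ₁ * (u + γ₂)) *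
      jacobiTheta₂ (u + γ₂ + γ₁ * τ) τ := by
  unfold jTheta jacobiTheta₂
  rw [← tsum_mul_left]
  congr 1; ext m
  rw [jacobiTheta₂_term, ← Complex.exp_add]
  congr 1; ring

/-- the odd theta function -/
def th (τ u : ℂ) : ℂ := jTheta (1/2) (1/2) u τ

lemma th_eq (τ u : ℂ) : th τ u =
    cexp (Real.pi * I * τ / 4 + Real.pi * I * (u + 1/2)) * jacobiTheta₂ (u + 1/2 + τ/2) τ := by
  rw [th, jTheta_eq]
  push_cast
  congr 2 <;> ring

lemma jTheta_th (a b : ℝ) (u τ : ℂ) : jTheta (1/2 + a) (1/2 + b) u τ =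
    cexp (Real.pi * I * (a:ℂ)^2 * τ + 2 * Real.pi * I * a * (u + 1/2 + b)) *
      th τ (u + b + a * τ) := by
  rw [jTheta_eq, th_eq, ← mul_assoc, ← Complex.exp_add]
  push_cast
  congr 2 <;> ring

lemma th_add_one (τ u : ℂ) : th τ (u + 1) = - th τ u := by
  rw [th_eq, th_eq, show u + 1 + 1/2 + τ/2 = (u + 1/2 + τ/2) + 1 by ring, jacobiTheta₂_add_left,
    show Real.pi * I * τ / 4 + Real.pi * I * (u + 1 + 1/2) =
      Real.pi * I * τ / 4 + Real.pi * I * (u + 1/2) + Real.pi * I by ring, Complex.exp_add _ (Real.pi * I),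
    Complex.exp_pi_mul_I]
  ring

lemma th_add_tau (τ u : ℂ) : th τ (u + τ) = - cexp (-(Real.pi * I * (τ + 2 * u))) * th τ u := by
  rw [th_eq, th_eq, show u + τ + 1/2 + τ/2 = (u + 1/2 + τ/2) + τ by ring, jacobiTheta₂_add_left',
    ← mul_assoc, ← mul_assoc, ← Complex.exp_add]
  congr 1
  rw [neg_mul (cexp _), ← Complex.exp_add, ← neg_one_mul (cexp _), ← Complex.exp_pi_mul_I, ← Complex.exp_add]
  rw [Complex.exp_eq_exp_iff_exists_int]
  exact ⟨-1, by push_cast; ring⟩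

lemma th_diff {τ : ℂ} (hτ : 0 < τ.im) : Differentiable ℂ (th τ) := by
  have : th τ = fun u => cexp (Real.pi * I * τ / 4 + Real.pi * I * (u + 1/2)) * jacobiTheta₂ (u + 1/2 + τ/2) τ := by
    ext u; exact th_eq τ u
  rw [this]
  intro u
  apply DifferentiableAt.mul (by fun_prop)
  exact (differentiableAt_jacobiTheta₂_fst (u + 1/2 + τ/2) hτ).comp u
    (f := fun u => u + 1/2 + τ/2) (by fun_prop)

/-- even part -/
def ev (τ x : ℂ) : ℂ := jacobiTheta₂ (2 * x) (2 * τ)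
/-- odd part -/
def od (τ x : ℂ) : ℂ :=
  cexp (Real.pi * I * τ / 2 + 2 * Real.pi * I * x) * jacobiTheta₂ (2 * x + τ) (2 * τ)

lemma ev_diff {τ : ℂ} (hτ : 0 < τ.im) : Differentiable ℂ (ev τ) := by
  intro u
  have h2 : 0 < (2 * τ).im := by simpa using hτ
  exact (differentiableAt_jacobiTheta₂_fst (2 * u) h2).comp u
    (f := fun u => 2 * u) (by fun_prop)

lemma od_diff {τ : ℂ} (hτ : 0 < τ.im) : Differentiable ℂ (od τ) := by
  intro u
  have h2 : 0 < (2 * τ).im := by simpa using hτ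
  apply DifferentiableAt.mul (by fun_prop)
  exact (differentiableAt_jacobiTheta₂_fst (2 * u + τ) h2).comp u
    (f := fun u => 2 * u + τ) (by fun_prop)

def pairFun : (ℤ × ℤ) ⊕ (ℤ × ℤ) → ℤ × ℤ
  | .inl (k, l) => (k + l, k - l - 1)
  | .inr (k, l) => (k + l, k - l)

lemma pairFun_bij : Function.Bijective pairFun := by
  constructor
  · rintro (⟨k, l⟩ | ⟨k, l⟩) (⟨k', l'⟩ | ⟨k', l'⟩) h <;>
      simp only [pairFun, Prod.mk.injEq] at h <;> simp <;> omega
  · rintro ⟨m, n⟩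
    rcases Int.even_or_odd (m + n) with ⟨k, hk⟩ | ⟨k, hk⟩
    · exact ⟨.inr (k, m - k), by simp only [pairFun, Prod.mk.injEq]; omega⟩
    · exact ⟨.inl (k + 1, m - k - 1), by simp only [pairFun, Prod.mk.injEq]; omega⟩

lemma tsum_pair (F : ℤ × ℤ → ℂ) (sF : Summable F) :
    ∑' p, F p = ∑' p : ℤ × ℤ, F (p.1 + p.2, p.1 - p.2 - 1) + ∑' p : ℤ × ℤ, F (p.1 + p.2, p.1 - p.2) := by
  have sF' : Summable (F ∘ pairFun) := ((Equiv.ofBijective _ pairFun_bij).summable_iff).2 sF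
  have e4 : ∑' p, F p = ∑' q, (F ∘ pairFun) q :=
    ((Equiv.ofBijective _ pairFun_bij).tsum_eq F).symm
  rw [e4, Summable.tsum_sum (f := F ∘ pairFun) (sF'.comp_injective Sum.inl_injective)
    (sF'.comp_injective Sum.inr_injective)]
  rfl

lemma th_mul {τ : ℂ} (hτ : 0 < τ.im) (x z : ℂ) :
    th τ (x + z) * th τ (x - z) = ev τ x * od τ z - od τ x * ev τ z := by
  have h2 : 0 < (2 * τ).im := by simpa using hτ
  have s1 : ∀ z, Summable (fun n => ‖jacobiTheta₂_term n z τ‖) := fun z =>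
    ((summable_jacobiTheta₂_term_iff z τ).2 hτ).norm
  have s2 : ∀ z, Summable (fun n => ‖jacobiTheta₂_term n z (2*τ)‖) := fun z =>
    ((summable_jacobiTheta₂_term_iff z (2*τ)).2 h2).norm
  rw [th_eq, th_eq, ev, ev, od, od]
  rw [mul_mul_mul_comm, mul_left_comm (jacobiTheta₂ (2 * x) _), mul_assoc (cexp _) _ (jacobiTheta₂ (2 * z) _)]
  simp only [jacobiTheta₂]
  rw [tsum_mul_tsum_of_summable_norm (s1 _) (s1 _), tsum_mul_tsum_of_summable_norm (s2 _) (s2 _),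
    tsum_mul_tsum_of_summable_norm (s2 _) (s2 _),
    tsum_pair _ (summable_mul_of_summable_norm (s1 _) (s1 _)), mul_add (cexp _ * cexp _), sub_eq_add_neg (cexp _ * _)]
  congr 1
  · rw [← tsum_mul_left, ← tsum_mul_left]
    congr 1; ext ⟨k, l⟩
    simp only [jacobiTheta₂_term, ← Complex.exp_add]
    rw [Complex.exp_eq_exp_iff_exists_int]
    refine ⟨k, ?_⟩
    push_cast
    ring
  · rw [← tsum_mul_left, ← tsum_mul_left, ← tsum_neg]
    congr 1; ext ⟨k, l⟩
    simp only [jacobiTheta₂_term, ← Complex.exp_add]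
    rw [← neg_one_mul, ← Complex.exp_pi_mul_I, ← Complex.exp_add]
    rw [Complex.exp_eq_exp_iff_exists_int]
    refine ⟨k, ?_⟩
    push_cast
    ring

lemma th_neg {τ : ℂ} (hτ : 0 < τ.im) {u₀ : ℂ} (h0 : th τ u₀ ≠ 0) (u : ℂ) : th τ (-u) = - th τ u := by
  have h1 := th_mul hτ ((u₀ + u)/2) ((u₀ - u)/2)
  have h2 := th_mul hτ ((u₀ - u)/2) ((u₀ + u)/2)
  rw [show (u₀ + u)/2 + (u₀ - u)/2 = u₀ by ring, show (u₀ + u)/2 - (u₀ - u)/2 = u by ring] at h1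
  rw [show (u₀ - u)/2 + (u₀ + u)/2 = u₀ by ring, show (u₀ - u)/2 - (u₀ + u)/2 = -u by ring] at h2
  apply mul_left_cancel₀ h0
  rw [h2, mul_neg, h1]; ring

lemma th_zero {τ : ℂ} (hτ : 0 < τ.im) {u₀ : ℂ} (h0 : th τ u₀ ≠ 0) : th τ 0 = 0 := by
  have h := th_neg hτ h0 0
  rw [neg_zero] at h
  linear_combination h / 2

lemma hasDeriv_shift_add {f : ℂ → ℂ} (hf : Differentiable ℂ f) (X z : ℂ) :
    HasDerivAt (fun z => f (X + z)) (deriv f (X + z)) z := by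
  simpa using (hf (X + z)).hasDerivAt.comp_const_add X z

lemma hasDeriv_shift_sub {f : ℂ → ℂ} (hf : Differentiable ℂ f) (X z : ℂ) :
    HasDerivAt (fun z => f (X - z)) (-deriv f (X - z)) z := by
  simpa using (hf (X - z)).hasDerivAt.comp_const_sub X z

lemma diff_deriv {f : ℂ → ℂ} (hf : Differentiable ℂ f) : Differentiable ℂ (deriv f) := by
  have := hf.contDiff (n := 2)
  exact (contDiff_succ_iff_deriv (n := 1).1 this).2.2.differentiable (by norm_num)

lemma th_dz {τ : ℂ} (hτ : 0 < τ.im) (X z : ℂ) :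
    deriv (th τ) (X + z) * th τ (X - z) - th τ (X + z) * deriv (th τ) (X - z) =
      ev τ X * deriv (od τ) z - od τ X * deriv (ev τ) z := by
  have h1 := (hasDeriv_shift_add (th_diff hτ) X z).mul (hasDeriv_shift_sub (th_diff hτ) X z)
  have h2 := ((od_diff hτ z).hasDerivAt.const_mul (ev τ X)).sub
    ((ev_diff hτ z).hasDerivAt.const_mul (od τ X))
  have h3 : ((fun z => th τ (X + z)) * fun z => th τ (X - z)) =
      (fun z => ev τ X * od τ z) - fun z => od τ X * ev τ z := by
    ext w; exact th_mul hτ X w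
  rw [h3] at h1
  rw [← h1.unique h2]; ring

lemma th_dzz {τ : ℂ} (hτ : 0 < τ.im) (X : ℂ) :
    2 * (deriv (deriv (th τ)) X * th τ X - deriv (th τ) X ^ 2) =
      ev τ X * deriv (deriv (od τ)) 0 - od τ X * deriv (deriv (ev τ)) 0 := by
  have t := th_diff hτ
  have t' := diff_deriv t
  have h1 := ((hasDeriv_shift_add t' X 0).mul (hasDeriv_shift_sub t X 0)).sub
    ((hasDeriv_shift_add t X 0).mul (hasDeriv_shift_sub t' X 0))
  have h2 := ((diff_deriv (od_diff hτ) 0).hasDerivAt.const_mul (ev τ X)).sub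
    ((diff_deriv (ev_diff hτ) 0).hasDerivAt.const_mul (od τ X))
  have h3 : (((fun z => deriv (th τ) (X + z)) * fun z => th τ (X - z)) -
      (fun z => th τ (X + z)) * fun z => deriv (th τ) (X - z)) =
      (fun z => ev τ X * deriv (od τ) z) - fun z => od τ X * deriv (ev τ) z := by
    ext w; exact th_dz hτ X w
  rw [h3] at h1
  rw [← h1.unique h2]
  simp only [add_zero, sub_zero]; ring

lemma th_wr {τ : ℂ} (hτ : 0 < τ.im) {u₀ : ℂ} (h0 : th τ u₀ ≠ 0) (s : ℂ) :
    deriv (th τ) 0 * th τ (2 * s) = od τ s * deriv (ev τ) s - ev τ s * deriv (od τ) s := by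
  have h := th_dz hτ s s
  rw [sub_self, th_zero hτ h0, ← two_mul] at h
  linear_combination -h

/-- degenerate Fay identity -/
lemma th_fay {τ : ℂ} (hτ : 0 < τ.im) {u₀ : ℂ} (h0 : th τ u₀ ≠ 0) (x y ξ : ℂ) :
    - deriv (th τ) 0 * th τ (x - y) * (th τ (x + ξ) * th τ (y - ξ)) =
      th τ (x - y + ξ) * th τ ξ * (deriv (th τ) y * th τ x - th τ y * deriv (th τ) x)
      + th τ x * th τ y * (deriv (th τ) (x - y + ξ) * th τ ξ - th τ (x - y + ξ) * deriv (th τ) ξ) := by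
  have e0 := th_wr hτ h0 ((x - y)/2)
  have e1 := th_mul hτ ((x + y)/2) ((x - y)/2 + ξ)
  have e2 := th_mul hτ ((x - y)/2 + ξ) ((x - y)/2)
  have e3 := th_mul hτ ((x + y)/2) ((x - y)/2)
  have e4 := th_dz hτ ((x + y)/2) ((x - y)/2)
  have e5 := th_dz hτ ((x - y)/2 + ξ) ((x - y)/2)
  rw [show 2 * ((x - y)/2) = x - y by ring] at e0
  rw [show (x + y)/2 + ((x - y)/2 + ξ) = x + ξ by ring, show (x + y)/2 - ((x - y)/2 + ξ) = y - ξ by ring] at e1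
  rw [show (x - y)/2 + ξ + (x - y)/2 = x - y + ξ by ring, show (x - y)/2 + ξ - (x - y)/2 = ξ by ring] at e2 e5
  rw [show (x + y)/2 + (x - y)/2 = x by ring, show (x + y)/2 - (x - y)/2 = y by ring] at e3 e4
  have e4' : deriv (th τ) y * th τ x - th τ y * deriv (th τ) x =
    -(ev τ ((x + y)/2) * deriv (od τ) ((x - y)/2) - od τ ((x + y)/2) * deriv (ev τ) ((x - y)/2)) := by
    rw [← e4]; ring
  rw [neg_mul, e0, e1, e2, e3, e4', e5]
  ring

lemma th_wp {τ : ℂ} (hτ : 0 < τ.im) {u₀ : ℂ} (h0 : th τ u₀ ≠ 0) (x ξ : ℂ) :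
    deriv (th τ) 0 ^ 2 * (th τ (x + ξ) * th τ (x - ξ)) =
      th τ x ^ 2 * (deriv (th τ) ξ ^ 2 - deriv (deriv (th τ)) ξ * th τ ξ)
      - th τ ξ ^ 2 * (deriv (th τ) x ^ 2 - deriv (deriv (th τ)) x * th τ x) := by
  have e0 := th_dzz hτ 0
  have e1 := th_dzz hτ x
  have e2 := th_dzz hτ ξ
  have e3 := th_mul hτ x 0
  have e4 := th_mul hτ ξ 0
  have e5 := th_mul hτ x ξ
  rw [th_zero hτ h0] at e0
  simp only [add_zero, sub_zero] at e3 e4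
  rw [show th τ x ^ 2 = th τ x * th τ x by ring, show th τ ξ ^ 2 = th τ ξ * th τ ξ by ring, e3, e4, e5]
  rw [show deriv (th τ) 0 ^ 2 = -(1/2) * (2 * (deriv (deriv (th τ)) 0 * 0 - deriv (th τ) 0 ^ 2)) by ring, e0]
  rw [show deriv (th τ) ξ ^ 2 - deriv (deriv (th τ)) ξ * th τ ξ =
    -(1/2) * (2 * (deriv (deriv (th τ)) ξ * th τ ξ - deriv (th τ) ξ ^ 2)) by ring, e2]
  rw [show deriv (th τ) x ^ 2 - deriv (deriv (th τ)) x * th τ x =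
    -(1/2) * (2 * (deriv (deriv (th τ)) x * th τ x - deriv (th τ) x ^ 2)) by ring, e1]
  ring

lemma th_deriv_ne {τ : ℂ} (hτ : 0 < τ.im) {u₀ : ℂ} (h0 : th τ u₀ ≠ 0) : deriv (th τ) 0 ≠ 0 := by
  intro hd
  -- a point where `od` does not vanish
  obtain ⟨s, hs⟩ : ∃ s, od τ s ≠ 0 := by
    by_contra! hc
    have h := th_mul hτ u₀ 0
    simp only [hc, add_zero, sub_zero, mul_zero, zero_mul, sub_self, mul_self_eq_zero] at h
    exact h0 h
  obtain ⟨ε, hε, hball⟩ := Metric.eventually_nhds_iff_ball.1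
    ((od_diff hτ).continuous.continuousAt.eventually_ne hs)
  have hev : ∀ z ∈ Metric.ball s ε, ev τ z / od τ z = ev τ s / od τ s := by
    intro z hz
    have hcvx := (convex_ball (E := ℂ) s ε)
    refine (Metric.isOpen_ball (x := s) (ε := ε)).is_const_of_deriv_eq_zero (𝕜 := ℂ)
      (f := fun z => ev τ z / od τ z) hcvx.isPreconnected ?_ ?_ hz (Metric.mem_ball_self hε)
    · intro w hw
      exact ((ev_diff hτ w).div (od_diff hτ w) (hball w hw)).differentiableWithinAt
    · intro w hw
      have := ((ev_diff hτ w).hasDerivAt.div (od_diff hτ w).hasDerivAt (hball w hw)).deriv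
      have h2 := th_wr hτ h0 w
      rw [hd, zero_mul] at h2
      simp only [Pi.zero_apply]
      erw [this]
      rw [mul_comm, ← h2, zero_div]
  have hK : ev τ = fun z => ev τ s / od τ s * od τ z := by
    apply AnalyticOnNhd.eq_of_eventuallyEq (𝕜 := ℂ) (z₀ := s)
    · exact (ev_diff hτ).differentiableOn.analyticOnNhd isOpen_univ
    · exact ((od_diff hτ).const_mul _).differentiableOn.analyticOnNhd isOpen_univ
    · filter_upwards [Metric.ball_mem_nhds s hε] with z hz
      rw [← hev z hz, div_mul_cancel₀ _ (hball z hz)]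
  have h := th_mul hτ u₀ 0
  rw [hK] at h
  simp only [add_zero, sub_zero] at h
  apply h0
  rw [← mul_self_eq_zero, h]; ring

lemma integral_shift {f : ℂ → ℂ} (hf : Differentiable ℂ f) (hp : ∀ u, f (u + 1) = f u) (w : ℂ) :
    ∫ t in (0:ℝ)..1, f (t + w) = ∫ t in (0:ℝ)..1, f t := by
  obtain ⟨H, hH⟩ := hf.isExactOn_univ
  have hH' : ∀ u, HasDerivAt H (f u) u := fun u => hH u (Set.mem_univ u)
  have key : ∀ w : ℂ, ∫ t in (0:ℝ)..1, f (t + w) = H (1 + w) - H (0 + w) := by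
    intro w
    have := intervalIntegral.integral_eq_sub_of_hasDerivAt (a := 0) (b := 1)
      (f := fun t : ℝ => H (t + w)) (f' := fun t : ℝ => f (t + w)) ?_ ?_
    · simpa using this
    · intro t _
      exact ((hH' (t + w)).comp_add_const (t : ℂ) w).comp_ofReal
    · apply Continuous.intervalIntegrable
      exact hf.continuous.comp (by fun_prop)
  have hc : ∀ u v : ℂ, H (u + 1) - H u = H (v + 1) - H v := by
    apply is_const_of_deriv_eq_zero (𝕜 := ℂ) (f := fun u => H (u + 1) - H u)
    · intro u
      exact (((hH' (u + 1)).comp_add_const u 1).sub (hH' u)).differentiableAt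
    · intro u
      have h := (((hH' (u + 1)).comp_add_const u 1).sub (hH' u)).deriv
      rw [hp, sub_self] at h
      exact h
  have h0 := key 0
  simp only [add_zero] at h0
  rw [key, h0, add_comm (1:ℂ) w, zero_add, hc w 0, zero_add]

lemma eq_zero_of_coeff {f : ℂ → ℂ} (hf : Differentiable ℂ f) (hp : ∀ u, f (u + 1) = f u)
    (hc : ∀ n : ℤ, ∫ t in (0:ℝ)..1, cexp (-(2 * Real.pi * I * n * t)) * f t = 0) (u : ℂ) : f u = 0 := by
  have hper : Function.Periodic (fun t : ℝ => f t) 1 := by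
    intro t; simp only [ofReal_add, ofReal_one, hp]
  have hcont : Continuous (hper.lift : AddCircle (1:ℝ) → ℂ) := by
    refine Continuous.quotient_lift (f := fun t : ℝ => f t) (hf.continuous.comp continuous_ofReal) _
  let F : C(AddCircle (1:ℝ), ℂ) := ⟨hper.lift, hcont⟩
  have hF : ∀ t : ℝ, F (t : AddCircle (1:ℝ)) = f t := fun t => rfl
  have hcoef : fourierCoeff F = 0 := by
    ext n
    rw [fourierCoeff_eq_intervalIntegral _ n 0]
    simp only [hF, fourier_coe_apply, Pi.zero_apply, smul_eq_mul]
    have := hc n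
    rw [zero_add]
    simp only [smul_eq_zero]
    right
    rw [← this]
    congr 1; ext t
    congr 2
    push_cast; ring
  have hsum : Summable (fourierCoeff F) := by rw [hcoef]; exact summable_zero
  have hreal : ∀ t : ℝ, f t = 0 := by
    intro t
    have h := has_pointwise_sum_fourier_series_of_summable hsum (t : AddCircle (1:ℝ))
    rw [hcoef] at h
    simp only [Pi.zero_apply, zero_smul] at h
    exact (h.unique hasSum_zero)
  have han : AnalyticOnNhd ℂ f Set.univ := hf.differentiableOn.analyticOnNhd isOpen_univ
  have := han.eq_of_frequently_eq (g := fun _ => 0) (z₀ := 0) (fun _ _ => analyticAt_const) ?_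
  · exact congrFun this u
  · have ht : Filter.Tendsto (fun n : ℕ => (((1 / ((n:ℝ) + 1) : ℝ)) : ℂ)) Filter.atTop (nhdsWithin 0 {0}ᶜ) := by
      apply tendsto_nhdsWithin_iff.2
      constructor
      · have := (continuous_ofReal.tendsto 0).comp (tendsto_one_div_add_atTop_nhds_zero_nat (𝕜 := ℝ))
        simpa [Function.comp_def] using this
      · apply Filter.Eventually.of_forall
        intro n
        simp only [Set.mem_compl_iff, Set.mem_singleton_iff, ofReal_eq_zero]
        positivity
    exact ht.frequently (Filter.Frequently.of_forall fun n => hreal _)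

/-- entire functions with the quasi-periodicity of `th` -/
structure ThetaLike (τ : ℂ) (f : ℂ → ℂ) : Prop where
  diff : Differentiable ℂ f
  one : ∀ u, f (u + 1) = - f u
  tau : ∀ u, f (u + τ) = - cexp (-(Real.pi * I * (τ + 2 * u))) * f u

def fc (f : ℂ → ℂ) (n : ℤ) : ℂ :=
  ∫ t in (0:ℝ)..1, f t * cexp (-(Real.pi * I * (2 * n + 1) * t))

lemma ThetaLike.fc_step {τ : ℂ} {f : ℂ → ℂ} (h : ThetaLike τ f) (n : ℤ) :
    fc f n = - cexp (-(Real.pi * I * (2 * n + 2) * τ)) * fc f (n + 1) := by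
  unfold fc
  have := integral_shift (f := fun u => f u * cexp (-(Real.pi * I * (2 * n + 1) * u)))
    (by have := h.diff; fun_prop) ?_ τ
  · rw [← this, ← intervalIntegral.integral_const_mul]
    congr 1; ext t
    rw [h.tau]
    have : cexp (-(Real.pi * I * (τ + 2 * t))) * cexp (-(Real.pi * I * (2 * n + 1) * (t + τ))) =
      cexp (-(Real.pi * I * (2 * n + 2) * τ)) * cexp (-(Real.pi * I * (2 * (n + 1 : ℤ) + 1) * t)) := by
      rw [← Complex.exp_add, ← Complex.exp_add]
      congr 1; push_cast; ring
    linear_combination (- f t) * this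
  · intro u
    rw [h.one, show -(Real.pi * I * (2 * n + 1) * (u + 1)) =
      -(Real.pi * I * (2 * n + 1) * u) + ((-n - 1 : ℤ) * (2 * Real.pi * I) + Real.pi * I) by push_cast; ring,
      Complex.exp_add, Complex.exp_add, Complex.exp_int_mul_two_pi_mul_I, Complex.exp_pi_mul_I]
    ring

lemma ThetaLike.eq_zero {τ : ℂ} {f : ℂ → ℂ} (h : ThetaLike τ f) (h0 : fc f 0 = 0) (u : ℂ) : f u = 0 := by
  have hall : ∀ n : ℤ, fc f n = 0 := by
    intro n
    induction n using Int.induction_on with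
    | zero => exact h0
    | succ i ih =>
      have := h.fc_step i
      rw [ih] at this
      simpa [Complex.exp_ne_zero] using this.symm
    | pred i ih =>
      rw [h.fc_step, sub_add_cancel, ih, mul_zero]
  have := eq_zero_of_coeff (f := fun u => f u * cexp (-(Real.pi * I * u)))
    (by have := h.diff; fun_prop) ?_ ?_ u
  · simpa [Complex.exp_ne_zero] using this
  · intro u
    rw [h.one, show -(Real.pi * I * (u + 1)) = -(Real.pi * I * u) - Real.pi * I by ring,
      Complex.exp_sub, Complex.exp_pi_mul_I]
    ring
  · intro n
    rw [← hall n, fc]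
    congr 1; ext t
    rw [mul_left_comm, ← Complex.exp_add]
    congr 2; ring

lemma th_thetaLike {τ : ℂ} (hτ : 0 < τ.im) : ThetaLike τ (th τ) :=
  ⟨th_diff hτ, th_add_one τ, th_add_tau τ⟩

lemma ThetaLike.eq_th {τ : ℂ} (hτ : 0 < τ.im) {u₀ : ℂ} (h0 : th τ u₀ ≠ 0) {f : ℂ → ℂ}
    (h : ThetaLike τ f) : ∃ C : ℂ, ∀ u, f u = C * th τ u := by
  have hT := th_thetaLike hτ
  have hne : fc (th τ) 0 ≠ 0 := fun hc => h0 (hT.eq_zero hc u₀)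
  refine ⟨fc f 0 / fc (th τ) 0, fun u => ?_⟩
  have hg : ThetaLike τ (fun u => f u - fc f 0 / fc (th τ) 0 * th τ u) := by
    refine ⟨h.diff.sub (hT.diff.const_mul _), fun u => ?_, fun u => ?_⟩
    · rw [h.one, hT.one]; ring
    · rw [h.tau, hT.tau]; ring
  have := hg.eq_zero ?_ u
  · exact sub_eq_zero.1 this
  · have hi : ∀ g : ℂ → ℂ, Differentiable ℂ g → IntervalIntegrable
        (fun t : ℝ => g t * cexp (-(Real.pi * I * (2 * (0:ℤ) + 1) * t))) MeasureTheory.volume 0 1 := by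
      intro g hg
      apply Continuous.intervalIntegrable
      have := hg.continuous
      fun_prop
    have : fc (fun u => f u - fc f 0 / fc (th τ) 0 * th τ u) 0 =
        fc f 0 - fc f 0 / fc (th τ) 0 * fc (th τ) 0 := by
      conv_lhs => rw [fc]
      simp only [sub_mul, mul_assoc (fc f 0 / fc (th τ) 0)]
      rw [intervalIntegral.integral_sub (hi f h.diff) ((hi _ hT.diff).const_mul _),
        intervalIntegral.integral_const_mul]
      rfl
    rw [this, div_mul_cancel₀ _ hne, sub_self]

/-- normalised translates of `th` -/
def sg (N : ℕ) (τ : ℂ) (j k : ℕ) (v : ℂ) : ℂ :=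
  cexp (2 * Real.pi * I * j / N * v) * th τ (v + (k + j * τ) / N)

lemma sg_diff (N : ℕ) {τ : ℂ} (hτ : 0 < τ.im) (j k : ℕ) : Differentiable ℂ (sg N τ j k) := by
  have := th_diff hτ
  unfold sg
  fun_prop

lemma sg_add_k {N : ℕ} (hN : (N:ℂ) ≠ 0) (τ : ℂ) (j k : ℕ) (v : ℂ) :
    sg N τ j (k + N) v = - sg N τ j k v := by
  unfold sg
  rw [show v + ((k + N : ℕ) + j * τ) / N = v + (k + j * τ) / N + 1 by push_cast; field_simp; ring,
    th_add_one]
  ring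

lemma sg_add_j {N : ℕ} (hN : (N:ℂ) ≠ 0) (τ : ℂ) (j k : ℕ) (v : ℂ) :
    sg N τ (j + N) k v = - cexp (-(Real.pi * I * (τ + 2 * ((k + j * τ) / N)))) * sg N τ j k v := by
  unfold sg
  rw [show v + (k + (j + N : ℕ) * τ) / N = v + (k + j * τ) / N + τ by push_cast; field_simp; ring,
    th_add_tau, ← mul_assoc, ← mul_assoc]
  congr 1
  rw [mul_neg, neg_mul (cexp _), ← Complex.exp_add, ← Complex.exp_add]
  congr 2
  push_cast; field_simp; ring

lemma sg_shift_one {N : ℕ} (τ : ℂ) (j k : ℕ) (v : ℂ) :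
    sg N τ j k (v + 1 / N) = cexp (2 * Real.pi * I * j / N / N) * sg N τ j (k + 1) v := by
  unfold sg
  rw [← mul_assoc, ← Complex.exp_add]
  congr 2
  · ring
  · push_cast; ring

lemma sg_shift_tau {N : ℕ} (τ : ℂ) (j k : ℕ) (v : ℂ) :
    sg N τ j k (v + τ / N) = cexp (2 * Real.pi * I * j / N / N * τ) *
      cexp (-(2 * Real.pi * I * v / N)) * sg N τ (j + 1) k v := by
  unfold sg
  rw [← mul_assoc, ← Complex.exp_add, ← Complex.exp_add]
  congr 2
  · push_cast; ring
  · push_cast; ring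

lemma prod_range_shift {N : ℕ} (hN : 0 < N) (f : ℕ → ℂ) (c : ℂ) (h : f N = c * f 0) :
    ∏ k ∈ Finset.range N, f (k + 1) = c * ∏ k ∈ Finset.range N, f k := by
  obtain ⟨M, rfl⟩ : ∃ M, N = M + 1 := ⟨N - 1, by omega⟩
  rw [Finset.prod_range_succ, Finset.prod_range_succ', h]; ring

lemma prod_exp_range (N : ℕ) (c : ℂ) :
    ∏ j ∈ Finset.range N, cexp (c * j) = cexp (c * (N * (N - 1) / 2)) := by
  induction N with
  | zero => simp
  | succ n ih =>
    rw [Finset.prod_range_succ, ih, ← Complex.exp_add]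
    congr 1; push_cast; ring

lemma exp_pi_nat (N : ℕ) : cexp (Real.pi * I * N) = (-1) ^ N := by
  rw [mul_comm, Complex.exp_nat_mul, Complex.exp_pi_mul_I]

def Gp (N : ℕ) (τ : ℂ) (v : ℂ) : ℂ :=
  ∏ j ∈ Finset.range N, ∏ k ∈ Finset.range N, sg N τ j k v

lemma Gp_thetaLike {N : ℕ} (hN : 0 < N) {τ : ℂ} (hτ : 0 < τ.im) :
    ThetaLike τ (fun u => Gp N τ (u / N)) := by
  have hN' : (N:ℂ) ≠ 0 := by exact_mod_cast hN.ne'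
  have hsq : ((-1:ℂ)) ^ N * (-1) ^ N = 1 := by rw [← mul_pow]; simp
  refine ⟨?_, fun u => ?_, fun u => ?_⟩
  · have := fun j k => sg_diff N hτ j k
    unfold Gp
    fun_prop
  · simp only [Gp]
    rw [add_div]
    simp only [sg_shift_one, Finset.prod_mul_distrib, Finset.prod_const, Finset.card_range]
    have e1 : ∀ j, ∏ k ∈ Finset.range N, sg N τ j (k + 1) (u / N) =
        (-1) * ∏ k ∈ Finset.range N, sg N τ j k (u / N) := by
      intro j
      apply prod_range_shift hN (fun k => sg N τ j k (u / N))
      have := sg_add_k hN' τ j 0 (u / N)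
      rw [zero_add] at this
      rw [this]; ring
    simp only [e1, Finset.prod_mul_distrib, Finset.prod_const, Finset.card_range]
    have e2 : ∏ j ∈ Finset.range N, cexp (2 * Real.pi * I * j / N / N) ^ N = - (-1) ^ N := by
      have : ∀ j : ℕ, cexp (2 * Real.pi * I * j / N / N) ^ N = cexp (2 * Real.pi * I / N * j) := by
        intro j
        rw [← Complex.exp_nat_mul]; congr 1; field_simp
      simp only [this]
      rw [prod_exp_range, ← exp_pi_nat, show 2 * Real.pi * I / N * (N * (N - 1) / 2) =
        Real.pi * I * N - Real.pi * I by field_simp, Complex.exp_sub, Complex.exp_pi_mul_I]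
      ring
    rw [e2, ← mul_assoc, neg_mul, hsq]; ring
  · simp only [Gp]
    rw [add_div]
    simp only [sg_shift_tau, Finset.prod_mul_distrib, Finset.prod_const, Finset.card_range]
    have e0 : ∏ k ∈ Finset.range N, sg N τ N k (u / N) =
        ((-1) ^ N * cexp (-(Real.pi * I * τ * N)) * cexp (-(2 * Real.pi * I / N) * (N * (N - 1) / 2))) *
        ∏ k ∈ Finset.range N, sg N τ 0 k (u / N) := by
      have : ∀ k, sg N τ N k (u / N) = (-1) * cexp (-(Real.pi * I * τ)) *
          cexp (-(2 * Real.pi * I / N) * k) * sg N τ 0 k (u / N) := by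
        intro k
        have := sg_add_j hN' τ 0 k (u / N)
        rw [zero_add] at this
        rw [this]
        congr 1
        rw [mul_assoc (-1:ℂ), ← Complex.exp_add, neg_one_mul]
        congr 2
        push_cast
        ring
      simp only [this, Finset.prod_mul_distrib, Finset.prod_const, Finset.card_range, prod_exp_range]
      rw [← Complex.exp_nat_mul]
      congr 4; ring
    rw [prod_range_shift hN (fun j => ∏ k ∈ Finset.range N, sg N τ j k (u / N)) _ e0]
    have e2 : ∏ j ∈ Finset.range N, cexp (2 * Real.pi * I * j / N / N * τ) ^ N =
        cexp (Real.pi * I * (N - 1) * τ) := by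
      have : ∀ j : ℕ, cexp (2 * Real.pi * I * j / N / N * τ) ^ N = cexp (2 * Real.pi * I / N * τ * j) := by
        intro j
        rw [← Complex.exp_nat_mul]; congr 1; field_simp
      simp only [this]
      rw [prod_exp_range]
      congr 1; field_simp
    rw [e2, ← mul_assoc]
    congr 1
    rw [← Complex.exp_nat_mul, ← Complex.exp_nat_mul, ← exp_pi_nat]
    simp only [← Complex.exp_add]
    rw [← neg_one_mul (cexp _), ← Complex.exp_pi_mul_I, ← Complex.exp_add]
    congr 1
    field_simp
    ring

lemma Gp_eq {N : ℕ} (hN : 0 < N) {τ : ℂ} (hτ : 0 < τ.im) {u₀ : ℂ} (h0 : th τ u₀ ≠ 0) :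
    ∃ C : ℂ, ∀ v, Gp N τ v = C * th τ (N * v) := by
  obtain ⟨C, hC⟩ := (Gp_thetaLike hN hτ).eq_th hτ h0
  have hN' : (N:ℂ) ≠ 0 := by exact_mod_cast hN.ne'
  refine ⟨C, fun v => ?_⟩
  rw [← hC, mul_div_cancel_left₀ _ hN']

def Eth (τ x : ℂ) : ℂ := deriv (th τ) x / th τ x
def Edd (τ x : ℂ) : ℂ :=
  (deriv (deriv (th τ)) x * th τ x - deriv (th τ) x ^ 2) / th τ x ^ 2

lemma Eth_hasDeriv {τ : ℂ} (hτ : 0 < τ.im) {x : ℂ} (hx : th τ x ≠ 0) :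
    HasDerivAt (Eth τ) (Edd τ x) x := by
  have t := th_diff hτ
  have := ((diff_deriv t) x).hasDerivAt.div (t x).hasDerivAt hx
  refine HasDerivAt.congr_deriv (f := Eth τ) this ?_
  unfold Edd; ring

lemma Gp_eq_prod (N : ℕ) (τ v : ℂ) : Gp N τ v =
    ∏ p ∈ Finset.range N ×ˢ Finset.range N, sg N τ p.1 p.2 v := by
  rw [Gp, Finset.prod_product]

lemma logDeriv_sg (N : ℕ) {τ : ℂ} (hτ : 0 < τ.im) (j k : ℕ) (v : ℂ) (h : sg N τ j k v ≠ 0) :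
    logDeriv (sg N τ j k) v = 2 * Real.pi * I * j / N + Eth τ (v + (k + j * τ) / N) := by
  have t := th_diff hτ
  have h1 : HasDerivAt (fun v => th τ (v + (k + j * τ) / N)) (deriv (th τ) (v + (k + j * τ) / N)) v :=
    (t _).hasDerivAt.comp_add_const v _
  have h2 : HasDerivAt (fun v => cexp (2 * Real.pi * I * j / N * v))
      (cexp (2 * Real.pi * I * j / N * v) * (2 * Real.pi * I * j / N)) v := by
    have := ((hasDerivAt_id v).const_mul (2 * Real.pi * I * j / N)).cexp
    simpa using this
  have h3 := (h2.mul h1).deriv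
  have hth : th τ (v + (k + j * τ) / N) ≠ 0 := by
    intro hc; apply h; rw [sg, hc, mul_zero]
  rw [logDeriv_apply, Eth]
  have : deriv (sg N τ j k) v = _ := h3
  rw [this, sg]
  have := Complex.exp_ne_zero (2 * Real.pi * I * j / N * v)
  rw [div_eq_iff (mul_ne_zero this hth), add_mul]
  congr 1
  · ring
  · field_simp

lemma exists_th_ne {N : ℕ} (hN : 0 < N) {τ : ℂ} (hτ : 0 < τ.im) {η : ℂ}
    (hne : ∀ j < N, ∀ k < N, sg N τ j k η ≠ 0) : ∃ u₀, th τ u₀ ≠ 0 := by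
  refine ⟨η, fun hc => hne 0 hN 0 hN ?_⟩
  simp [sg, hc]

lemma exists_C {N : ℕ} (hN : 0 < N) {τ : ℂ} (hτ : 0 < τ.im) {η : ℂ}
    (hne : ∀ j < N, ∀ k < N, sg N τ j k η ≠ 0) : ∃ C : ℂ, C ≠ 0 ∧ th τ (N * η) ≠ 0 ∧ ∀ v, Gp N τ v = C * th τ (N * v) := by
  obtain ⟨u₀, h0⟩ := exists_th_ne hN hτ hne
  obtain ⟨C, hC⟩ := Gp_eq hN hτ h0
  have : Gp N τ η ≠ 0 := by
    rw [Gp, Finset.prod_ne_zero_iff]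
    intro j hj
    rw [Finset.prod_ne_zero_iff]
    intro k hk
    exact hne j (Finset.mem_range.1 hj) k (Finset.mem_range.1 hk)
  rw [hC] at this
  exact ⟨C, left_ne_zero_of_mul this, right_ne_zero_of_mul this, hC⟩

lemma th_torsion_ne {N : ℕ} (hN : 0 < N) {τ : ℂ} (hτ : 0 < τ.im) {η : ℂ}
    (hne : ∀ j < N, ∀ k < N, sg N τ j k η ≠ 0) (j k : ℕ) (hj : j < N) (hk : k < N) (hjk : (j, k) ≠ (0, 0)) :
    th τ ((k + j * τ) / N) ≠ 0 := by
  obtain ⟨u₀, h0⟩ := exists_th_ne hN hτ hne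
  obtain ⟨C, hC0, -, hC⟩ := exists_C hN hτ hne
  have t := th_diff hτ
  have hd := th_deriv_ne hτ h0
  have hN' : (N:ℂ) ≠ 0 := by exact_mod_cast hN.ne'
  set S := (Finset.range N ×ˢ Finset.range N).erase (0, 0) with hS
  have hrest : Differentiable ℂ (fun v => ∏ p ∈ S, sg N τ p.1 p.2 v) := by
    have := fun j k => sg_diff N hτ j k
    fun_prop
  have heq : (fun v => C * th τ (N * v)) = th τ * (fun v => ∏ p ∈ S, sg N τ p.1 p.2 v) := by
    ext v
    rw [← hC, Gp_eq_prod, ← Finset.mul_prod_erase _ _ (a := (0, 0))]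
    · simp [sg, hS]
    · simp [hN]
  have h1 := (t 0).hasDerivAt.mul (hrest 0).hasDerivAt
  have h2 : HasDerivAt (fun v => C * th τ (N * v)) (C * (deriv (th τ) 0 * N)) 0 := by
    apply HasDerivAt.const_mul
    have h3 : HasDerivAt (fun v : ℂ => (N:ℂ) * v) N 0 := by
      simpa using (hasDerivAt_id (0:ℂ)).const_mul (N:ℂ)
    have h4 : HasDerivAt (th τ) (deriv (th τ) 0) ((N:ℂ) * 0) := by
      rw [mul_zero]; exact (t 0).hasDerivAt
    exact h4.comp 0 h3
  rw [heq] at h2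
  have h5 := h2.unique h1
  rw [th_zero hτ h0, zero_mul, add_zero] at h5
  have h6 : (∏ p ∈ S, sg N τ p.1 p.2 0) ≠ 0 := by
    intro hc
    rw [hc, mul_zero] at h5
    exact mul_ne_zero hC0 (mul_ne_zero hd hN') h5
  rw [Finset.prod_ne_zero_iff] at h6
  have := h6 (j, k) (by rw [hS, Finset.mem_erase]; exact ⟨hjk, by simp [hj, hk]⟩)
  simpa [sg] using this

lemma sum_Eth {N : ℕ} (hN : 0 < N) {τ : ℂ} (hτ : 0 < τ.im) {η : ℂ}
    (hne : ∀ j < N, ∀ k < N, sg N τ j k η ≠ 0) : ∑ p ∈ Finset.range N ×ˢ Finset.range N, Edd τ (η + (p.2 + p.1 * τ) / N) =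
    N ^ 2 * Edd τ (N * η) := by
  obtain ⟨C, hC0, hNη, hC⟩ := exists_C hN hτ hne
  have t := th_diff hτ
  have hcont : Continuous (fun v : ℂ => th τ (N * v)) := t.continuous.comp (by fun_prop)
  have hev : (fun v => ∑ p ∈ Finset.range N ×ˢ Finset.range N,
      (2 * Real.pi * I * p.1 / N + Eth τ (v + (p.2 + p.1 * τ) / N))) =ᶠ[nhds η]
      (fun v => N * Eth τ (N * v)) := by
    filter_upwards [hcont.continuousAt.eventually_ne hNη] with v hv
    have hG : Gp N τ v ≠ 0 := by rw [hC]; exact mul_ne_zero hC0 hv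
    have hf : ∀ p ∈ Finset.range N ×ˢ Finset.range N, sg N τ p.1 p.2 v ≠ 0 := by
      rw [Gp_eq_prod, Finset.prod_ne_zero_iff] at hG; exact hG
    have e1 : logDeriv (Gp N τ) v = ∑ p ∈ Finset.range N ×ˢ Finset.range N,
      (2 * Real.pi * I * p.1 / N + Eth τ (v + (p.2 + p.1 * τ) / N)) := by
      have : Gp N τ = fun v => ∏ p ∈ Finset.range N ×ˢ Finset.range N, sg N τ p.1 p.2 v := by
        ext v; exact Gp_eq_prod N τ v
      rw [this, logDeriv_prod hf (fun p _ => sg_diff N hτ p.1 p.2 v)]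
      exact Finset.sum_congr rfl fun p hp => logDeriv_sg N hτ p.1 p.2 v (hf p hp)
    have e2 : logDeriv (Gp N τ) v = N * Eth τ (N * v) := by
      have : Gp N τ = fun v => C * th τ (N * v) := by ext v; exact hC v
      rw [this, logDeriv_apply]
      have h3 : HasDerivAt (fun v : ℂ => (N:ℂ) * v) N v := by
        simpa using (hasDerivAt_id v).const_mul (N:ℂ)
      have h4 := ((t (N * v)).hasDerivAt.comp v h3).const_mul C
      have h5 : deriv (fun v => C * th τ (N * v)) v = _ := h4.deriv
      rw [h5, Eth]
      field_simp
    rw [← e1, e2]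
  have d1 : HasDerivAt (fun v => ∑ p ∈ Finset.range N ×ˢ Finset.range N,
      (2 * Real.pi * I * p.1 / N + Eth τ (v + (p.2 + p.1 * τ) / N)))
      (∑ p ∈ Finset.range N ×ˢ Finset.range N, Edd τ (η + (p.2 + p.1 * τ) / N)) η := by
    apply HasDerivAt.fun_sum
    intro p hp
    rw [Finset.mem_product, Finset.mem_range, Finset.mem_range] at hp
    apply HasDerivAt.const_add
    have : th τ (η + (p.2 + p.1 * τ) / N) ≠ 0 := by
      intro hc; apply hne p.1 hp.1 p.2 hp.2; rw [sg, hc, mul_zero]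
    exact (Eth_hasDeriv hτ this).comp_add_const η _
  have d2 : HasDerivAt (fun v => N * Eth τ (N * v)) (N * (Edd τ (N * η) * N)) η := by
    apply HasDerivAt.const_mul
    have h3 : HasDerivAt (fun v : ℂ => (N:ℂ) * v) N η := by
      simpa using (hasDerivAt_id η).const_mul (N:ℂ)
    exact (Eth_hasDeriv hτ hNη).comp η h3
  rw [(d1.congr_of_eventuallyEq hev.symm).unique d2]
  ring

/-- the diagonal coefficient -/
lemma sum_diag {N : ℕ} (hN : 0 < N) {τ : ℂ} (hτ : 0 < τ.im) {η : ℂ}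
    (hne : ∀ j < N, ∀ k < N, sg N τ j k η ≠ 0) (ξ : ℂ) : ∑ p ∈ Finset.range N ×ˢ Finset.range N,
    (sg N τ p.1 p.2 (η + ξ) / sg N τ p.1 p.2 η) * (sg N τ p.1 p.2 (η - ξ) / sg N τ p.1 p.2 η) =
    N ^ 2 * (th τ (N * η + ξ) * th τ (N * η - ξ) / th τ (N * η) ^ 2) := by
  obtain ⟨u₀, h0⟩ := exists_th_ne hN hτ hne
  obtain ⟨C, hC0, hNη, hC⟩ := exists_C hN hτ hne
  have hd := th_deriv_ne hτ h0
  have key : ∀ x, th τ x ≠ 0 → th τ (x + ξ) * th τ (x - ξ) / th τ x ^ 2 =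
      (deriv (th τ) ξ ^ 2 - deriv (deriv (th τ)) ξ * th τ ξ) / deriv (th τ) 0 ^ 2 +
      th τ ξ ^ 2 / deriv (th τ) 0 ^ 2 * Edd τ x := by
    intro x hx
    have := th_wp hτ h0 x ξ
    rw [Edd]
    field_simp
    linear_combination this
  have h1 : ∀ p ∈ Finset.range N ×ˢ Finset.range N,
      (sg N τ p.1 p.2 (η + ξ) / sg N τ p.1 p.2 η) * (sg N τ p.1 p.2 (η - ξ) / sg N τ p.1 p.2 η) =
      (deriv (th τ) ξ ^ 2 - deriv (deriv (th τ)) ξ * th τ ξ) / deriv (th τ) 0 ^ 2 +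
      th τ ξ ^ 2 / deriv (th τ) 0 ^ 2 * Edd τ (η + (p.2 + p.1 * τ) / N) := by
    intro p hp
    rw [Finset.mem_product, Finset.mem_range, Finset.mem_range] at hp
    have hx : th τ (η + (p.2 + p.1 * τ) / N) ≠ 0 := by
      intro hc; apply hne p.1 hp.1 p.2 hp.2; rw [sg, hc, mul_zero]
    rw [← key _ hx]
    unfold sg
    rw [show η + ξ + (p.2 + p.1 * τ) / N = η + (p.2 + p.1 * τ) / N + ξ by ring,
      show η - ξ + (p.2 + p.1 * τ) / N = η + (p.2 + p.1 * τ) / N - ξ by ring]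
    have e := Complex.exp_ne_zero (2 * Real.pi * I * p.1 / N * η)
    rw [mul_add, mul_sub, Complex.exp_add, Complex.exp_sub]
    have e' := Complex.exp_ne_zero (2 * Real.pi * I * p.1 / N * ξ)
    field_simp
  rw [Finset.sum_congr rfl h1, Finset.sum_add_distrib, ← Finset.mul_sum, sum_Eth hN hτ hne,
    key _ hNη]
  simp only [Finset.sum_const, Finset.card_product, Finset.card_range, nsmul_eq_mul]
  push_cast; ring

def ww (N : ℕ) (τ η ξ : ℂ) (a b : ℕ) : ℂ := sg N τ a b (η + ξ) / sg N τ a b η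

lemma ww_per2 {N : ℕ} (hN : (N:ℂ) ≠ 0) (τ η ξ : ℂ) (a : ℕ) :
    Function.Periodic (fun b => ww N τ η ξ a b) N := by
  intro b
  simp only [ww, sg_add_k hN, neg_div_neg_eq]

lemma ww_per1 {N : ℕ} (hN : (N:ℂ) ≠ 0) (τ η ξ : ℂ) (b : ℕ) :
    Function.Periodic (fun a => ww N τ η ξ a b) N := by
  intro a
  simp only [ww, sg_add_j hN]
  exact mul_div_mul_left _ _ (neg_ne_zero.2 (Complex.exp_ne_zero _))

lemma ww_mod {N : ℕ} (hN : (N:ℂ) ≠ 0) (τ η ξ : ℂ) (a b : ℕ) :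
    ww N τ η ξ (a % N) (b % N) = ww N τ η ξ a b := by
  rw [(ww_per2 hN τ η ξ (a % N)).map_mod_nat b]
  exact (ww_per1 hN τ η ξ b).map_mod_nat a

def ee (N : ℕ) (τ η : ℂ) (a b : ℕ) : ℂ := logDeriv (sg N τ a b) η

lemma ee_mod {N : ℕ} (hN : (N:ℂ) ≠ 0) (τ η : ℂ) (a b : ℕ) :
    ee N τ η (a % N) (b % N) = ee N τ η a b := by
  have p2 : ∀ a, Function.Periodic (fun b => ee N τ η a b) N := by
    intro a b
    have : sg N τ a (b + N) = fun v => (-1) * sg N τ a b v := by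
      ext v; rw [sg_add_k hN]; ring
    simp only [ee, this]
    exact logDeriv_const_mul _ _ (by norm_num)
  have p1 : ∀ b, Function.Periodic (fun a => ee N τ η a b) N := by
    intro b a
    have : sg N τ (a + N) b = fun v =>
      (- cexp (-(Real.pi * I * (τ + 2 * ((b + a * τ) / N))))) * sg N τ a b v := by
      ext v; rw [sg_add_j hN]
    simp only [ee, this]
    exact logDeriv_const_mul _ _ (neg_ne_zero.2 (Complex.exp_ne_zero _))
  rw [(p2 (a % N)).map_mod_nat b]
  exact (p1 b).map_mod_nat a

lemma sg_ne_all {N : ℕ} (hN : 0 < N) {τ : ℂ} {η : ℂ}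
    (hne : ∀ j < N, ∀ k < N, sg N τ j k η ≠ 0) (j k : ℕ) : sg N τ j k η ≠ 0 := by
  have hN' : (N:ℂ) ≠ 0 := by exact_mod_cast hN.ne'
  have p2 : ∀ a, Function.Periodic (fun b => (sg N τ a b η = 0)) N := by
    intro a b
    simp only [sg_add_k hN', neg_eq_zero]
  have p1 : ∀ b, Function.Periodic (fun a => (sg N τ a b η = 0)) N := by
    intro b a
    simp only [sg_add_j hN', mul_eq_zero, neg_eq_zero, Complex.exp_ne_zero, false_or]
  have h := hne (j % N) (Nat.mod_lt _ hN) (k % N) (Nat.mod_lt _ hN)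
  rw [Ne, (p2 (j % N)).map_mod_nat k] at h
  have := (p1 k).map_mod_nat j
  rwa [Ne, ← this]

/-- the character -/
def chi (N : ℕ) (c d a b : ℕ) : ℂ :=
  cexp (2 * Real.pi * I * (d * a - c * b) / N)

lemma chi_per {N : ℕ} (hN : (N:ℂ) ≠ 0) (c d a b : ℕ) :
    chi N c d (a % N) (b % N) = chi N c d a b := by
  have p2 : ∀ a, Function.Periodic (fun b => chi N c d a b) N := by
    intro a b
    simp only [chi]
    rw [Complex.exp_eq_exp_iff_exists_int]
    exact ⟨-c, by push_cast; field_simp; ring⟩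
  have p1 : ∀ b, Function.Periodic (fun a => chi N c d a b) N := by
    intro b a
    simp only [chi]
    rw [Complex.exp_eq_exp_iff_exists_int]
    exact ⟨d, by push_cast; field_simp; ring⟩
  rw [(p2 (a % N)).map_mod_nat b]
  exact (p1 b).map_mod_nat a

lemma chi_add {N : ℕ} (c d a b a' b' : ℕ) :
    chi N c d (a + a') (b + b') = chi N c d a b * chi N c d a' b' := by
  rw [chi, chi, chi, ← Complex.exp_add]
  congr 1; push_cast; ring

lemma chi_self {N : ℕ} (c d : ℕ) : chi N c d c d = 1 := by
  rw [chi, mul_comm (d:ℂ), sub_self]; simp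

lemma chi_ne_one {N : ℕ} (hN : 0 < N) (c : ℕ) (h0 : 0 < c) (hc : c < N) :
    cexp (2 * Real.pi * I * c / N) ≠ 1 := by
  intro h
  have h1 := (Complex.isPrimitiveRoot_exp N hN.ne').pow_ne_one_of_pos_of_lt h0.ne' hc
  apply h1
  rw [← Complex.exp_nat_mul, ← h]
  congr 1; ring

lemma shift_sum {N : ℕ} [NeZero N] (c d : Fin N) (f : ℕ → ℕ → ℂ)
    (hf : ∀ a b, f (a % N) (b % N) = f a b) :
    ∑ β : Fin N × Fin N, f (β.1 + c) (β.2 + d) = ∑ β : Fin N × Fin N, f β.1 β.2 := by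
  rw [← Equiv.sum_comp (Equiv.addRight (c, d)) (fun β : Fin N × Fin N => f β.1 β.2)]
  refine Finset.sum_congr rfl fun β _ => ?_
  simp only [Equiv.coe_addRight, Prod.fst_add, Prod.snd_add, Fin.val_add, hf]

lemma chi_sum {N : ℕ} [NeZero N] (c d : Fin N) (h : (c, d) ≠ (0, 0)) :
    ∑ β : Fin N × Fin N, chi N c d β.1 β.2 = 0 := by
  have hN : 0 < N := Nat.pos_of_ne_zero (NeZero.ne N)
  have hN' : (N:ℂ) ≠ 0 := by exact_mod_cast hN.ne'
  have key : ∀ a' b' : Fin N, chi N c d a' b' ≠ 1 →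
      ∑ β : Fin N × Fin N, chi N c d β.1 β.2 = 0 := by
    intro a' b' hne
    have := shift_sum a' b' (chi N c d) (chi_per hN' c d)
    simp only [chi_add] at this
    rw [← Finset.sum_mul] at this
    have h2 : (∑ β : Fin N × Fin N, chi N c d β.1 β.2) * (chi N c d a' b' - 1) = 0 := by
      linear_combination this
    exact (mul_eq_zero.1 h2).resolve_right (sub_ne_zero.2 hne)
  by_cases hd : d = 0
  · have hc : c ≠ 0 := by rintro rfl; exact h (by rw [hd])
    have hc' : 0 < (c:ℕ) := Nat.pos_of_ne_zero (fun h => hc (Fin.val_eq_zero_iff.1 h))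
    have hN1 : 1 < N := lt_of_le_of_lt hc' c.2
    apply key 0 ⟨1, hN1⟩
    have := chi_ne_one hN c hc' c.2
    intro h3; apply this
    rw [chi] at h3
    rw [← _root_.inv_inj, inv_one, ← Complex.exp_neg, ← h3]
    congr 1; simp; ring
  · have hc' : 0 < (d:ℕ) := Nat.pos_of_ne_zero (fun h => hd (Fin.val_eq_zero_iff.1 h))
    have hN1 : 1 < N := lt_of_le_of_lt hc' d.2
    apply key ⟨1, hN1⟩ 0
    have := chi_ne_one hN d hc' d.2
    intro h3; apply this
    rw [chi] at h3
    rw [← h3]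
    congr 1; simp

lemma sum_off {N : ℕ} [NeZero N] {τ : ℂ} (hτ : 0 < τ.im) {η : ℂ}
    (hne : ∀ j < N, ∀ k < N, sg N τ j k η ≠ 0) (ξ : ℂ) (c d : Fin N) (h : (c, d) ≠ (0, 0)) :
    ∑ β : Fin N × Fin N, chi N c d β.1 β.2 *
      (ww N τ η ξ (β.1 + c) (β.2 + d) * ww N τ η (-ξ) β.1 β.2) = 0 := by
  have hN : 0 < N := Nat.pos_of_ne_zero (NeZero.ne N)
  have hN' : (N:ℂ) ≠ 0 := by exact_mod_cast hN.ne'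
  obtain ⟨u₀, h0⟩ := exists_th_ne hN hτ hne
  have hd0 := th_deriv_ne hτ h0
  have htor := th_torsion_ne hN hτ hne c d c.2 d.2 (fun hh => h (by
    rw [Prod.mk.injEq] at hh
    rw [Fin.val_eq_zero_iff.1 hh.1, Fin.val_eq_zero_iff.1 hh.2]))
  have hall := sg_ne_all hN hne
  have hth : ∀ j k : ℕ, th τ (η + (k + j * τ) / N) ≠ 0 := by
    intro j k hc; apply hall j k; rw [sg, hc, mul_zero]
  obtain ⟨A, B, hAB⟩ : ∃ A B : ℂ, ∀ a b : ℕ,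
      ww N τ η ξ (a + c) (b + d) * ww N τ η (-ξ) a b =
        A + B * (ee N τ η a b - ee N τ η (a + c) (b + d)) := by
    set t := (((d:ℕ):ℂ) + (c:ℕ) * τ) / N with ht
    set E := cexp (2 * Real.pi * I * (c:ℕ) / N * ξ) with hE
    set D := deriv (th τ) 0 with hD
    refine ⟨-(E * (deriv (th τ) (t + ξ) * th τ ξ - th τ (t + ξ) * deriv (th τ) ξ) / (D * th τ t))
      - E * th τ (t + ξ) * th τ ξ / (D * th τ t) * (2 * Real.pi * I * (c:ℕ) / N),
      -(E * th τ (t + ξ) * th τ ξ / (D * th τ t)), fun a b => ?_⟩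
    have fay := th_fay hτ h0 (η + ((b + d : ℕ) + (a + c : ℕ) * τ) / N) (η + (b + a * τ) / N) ξ
    rw [show η + ((b + d : ℕ) + (a + c : ℕ) * τ) / N - (η + (b + a * τ) / N) = t by
      rw [ht]; push_cast; ring] at fay
    rw [ee, ee, logDeriv_sg N hτ _ _ _ (hall _ _), logDeriv_sg N hτ _ _ _ (hall _ _), Eth, Eth,
      ww, ww]
    have hx := hth (a + c) (b + d)
    have hy := hth a b
    unfold sg
    rw [show η + ξ + ((b + d : ℕ) + (a + c : ℕ) * τ) / N =
        η + ((b + d : ℕ) + (a + c : ℕ) * τ) / N + ξ by ring,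
      show η + -ξ + (b + a * τ) / N = η + (b + a * τ) / N - ξ by ring]
    set x := η + ((b + d : ℕ) + (a + c : ℕ) * τ) / N
    set y := η + (b + a * τ) / N
    have e1 := Complex.exp_ne_zero (2 * Real.pi * I * (a + c : ℕ) / N * η)
    have e2 := Complex.exp_ne_zero (2 * Real.pi * I * a / N * η)
    have e3 := Complex.exp_ne_zero (2 * Real.pi * I * a / N * ξ)
    have s1 : cexp (2 * Real.pi * I * (a + c : ℕ) / N * (η + ξ)) =
        cexp (2 * Real.pi * I * (a + c : ℕ) / N * η) *
          (cexp (2 * Real.pi * I * a / N * ξ) * E) := by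
      rw [hE, ← Complex.exp_add, ← Complex.exp_add]; congr 1; push_cast; ring
    have s2 : cexp (2 * Real.pi * I * a / N * (η + -ξ)) =
        cexp (2 * Real.pi * I * a / N * η) / (cexp (2 * Real.pi * I * a / N * ξ)) := by
      rw [← Complex.exp_sub]; congr 1; ring
    have L : cexp (2 * Real.pi * I * (a + c : ℕ) / N * (η + ξ)) * th τ (x + ξ) /
          (cexp (2 * Real.pi * I * (a + c : ℕ) / N * η) * th τ x) *
        (cexp (2 * Real.pi * I * a / N * (η + -ξ)) * th τ (y - ξ) /
          (cexp (2 * Real.pi * I * a / N * η) * th τ y)) =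
        E * (th τ (x + ξ) * th τ (y - ξ)) / (th τ x * th τ y) := by
      rw [s1, s2]
      field_simp
    rw [L]
    have fay' : th τ (x + ξ) * th τ (y - ξ) = -(th τ (t + ξ) * th τ ξ *
        (deriv (th τ) y * th τ x - th τ y * deriv (th τ) x) + th τ x * th τ y *
        (deriv (th τ) (t + ξ) * th τ ξ - th τ (t + ξ) * deriv (th τ) ξ)) / (D * th τ t) := by
      rw [eq_div_iff (mul_ne_zero hd0 htor)]
      linear_combination -fay
    rw [fay']
    push_cast
    field_simp
    ring
  simp only [hAB]
  have e1 : ∀ β : Fin N × Fin N, chi N c d β.1 β.2 *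
      (A + B * (ee N τ η β.1 β.2 - ee N τ η (β.1 + c) (β.2 + d))) =
      A * chi N c d β.1 β.2 + B * (chi N c d β.1 β.2 * ee N τ η β.1 β.2) -
        B * (chi N c d (β.1 + c) (β.2 + d) * ee N τ η (β.1 + c) (β.2 + d)) := by
    intro β
    rw [chi_add, chi_self]; ring
  rw [Finset.sum_congr rfl fun β _ => e1 β, Finset.sum_sub_distrib, Finset.sum_add_distrib,
    ← Finset.mul_sum, ← Finset.mul_sum, ← Finset.mul_sum, chi_sum c d h,
    shift_sum c d (fun a b => chi N c d a b * ee N τ η a b)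
      (fun a b => by rw [chi_per hN', ee_mod hN'])]
  ring

lemma eπ_add (x y : ℂ) : eπ (x + y) = eπ x * eπ y := by
  rw [eπ, eπ, eπ, ← Complex.exp_add]; congr 1; ring

lemma eπ_ne (x : ℂ) : eπ x ≠ 0 := Complex.exp_ne_zero _

lemma eπ_two_nat (n : ℕ) : eπ (2 * n) = 1 := by
  rw [eπ, Complex.exp_eq_one_iff]
  exact ⟨n, by push_cast; ring⟩

lemma hMat_mul {N : ℕ} [NeZero N] (M : Matrix (Fin N) (Fin N) ℂ) (j l : Fin N) :
    (hMat N * M) j l = M ⟨((j:ℕ) + 1) % N, Nat.mod_lt _ (NeZero.pos N)⟩ l := by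
  rw [Matrix.mul_apply, Finset.sum_eq_single ⟨((j:ℕ) + 1) % N, Nat.mod_lt _ (NeZero.pos N)⟩]
  · simp [hMat]
  · intro b _ hb
    have : ¬ ((b:ℕ) = ((j:ℕ) + 1) % N) := fun h => hb (Fin.ext h)
    simp [hMat, this]
  · simp

lemma hMat_pow {N : ℕ} [NeZero N] (k : ℕ) (j l : Fin N) :
    (hMat N ^ k) j l = if (l:ℕ) = ((j:ℕ) + k) % N then 1 else 0 := by
  induction k generalizing j with
  | zero =>
    rw [pow_zero, Matrix.one_apply, add_zero, Nat.mod_eq_of_lt j.2]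
    simp only [Fin.ext_iff, eq_comm]
  | succ k ih =>
    rw [pow_succ', hMat_mul, ih]
    simp only [Nat.mod_add_mod]
    rw [add_assoc, add_comm 1 k]

lemma hMat_pow_N {N : ℕ} [NeZero N] : hMat N ^ N = 1 := by
  ext j l
  rw [hMat_pow, Nat.add_mod_right, Nat.mod_eq_of_lt j.2, Matrix.one_apply]
  simp only [Fin.ext_iff, eq_comm]

lemma gMat_pow_N {N : ℕ} [NeZero N] : gMat N ^ N = 1 := by
  have hN' : (N:ℂ) ≠ 0 := by exact_mod_cast NeZero.ne N
  rw [gMat, Matrix.diagonal_pow, ← Matrix.diagonal_one]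
  congr 1
  ext j
  simp only [Pi.pow_apply]
  have h2 := eπ_two_nat ((j:ℕ) + 1)
  rw [eπ] at h2
  rw [eπ, ← Complex.exp_nat_mul]
  refine Eq.trans ?_ h2
  congr 1
  push_cast; field_simp

lemma hg_comm {N : ℕ} [NeZero N] : hMat N * gMat N = eπ (2 / N) • (gMat N * hMat N) := by
  have hN' : (N:ℂ) ≠ 0 := by exact_mod_cast NeZero.ne N
  ext j l
  rw [hMat_mul, Matrix.smul_apply, gMat, Matrix.diagonal_mul, Matrix.diagonal_apply]
  simp only [hMat, Matrix.of_apply, Fin.ext_iff, smul_eq_mul]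
  by_cases h : (l:ℕ) = ((j:ℕ) + 1) % N
  · rw [if_pos h.symm, if_pos h, mul_one, ← eπ_add]
    have hp : Function.Periodic (fun n : ℕ => eπ (2 * ((n:ℂ) + 1) / N)) N := by
      intro n
      simp only
      rw [show 2 * (((n + N : ℕ):ℂ) + 1) / N = 2 * ((n:ℂ) + 1) / N + 2 * (1:ℕ) by
        push_cast; field_simp; ring, eπ_add, eπ_two_nat, mul_one]
    have := hp.map_mod_nat ((j:ℕ) + 1)
    rw [this]
    congr 1; push_cast; ring
  · rw [if_neg (fun hh => h hh.symm), if_neg h]; simp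

lemma h_pow_g_pow {N : ℕ} [NeZero N] (a b : ℕ) :
    hMat N ^ a * gMat N ^ b = eπ (2 / N) ^ (a * b) • (gMat N ^ b * hMat N ^ a) := by
  have h1 : ∀ b : ℕ, hMat N * gMat N ^ b = eπ (2 / N) ^ b • (gMat N ^ b * hMat N) := by
    intro b
    induction b with
    | zero => simp
    | succ b ih =>
      rw [pow_succ, ← mul_assoc, ih, Matrix.smul_mul, mul_assoc, hg_comm, Matrix.mul_smul,
        smul_smul, pow_succ, ← mul_assoc]
  induction a with
  | zero => simp
  | succ a ih =>
    rw [pow_succ, mul_assoc, h1, Matrix.mul_smul, ← mul_assoc, ih, Matrix.smul_mul, smul_smul,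
      mul_assoc, ← pow_add]
    congr 2; ring

/-- `I` with natural number indices -/
def In (N : ℕ) (a b : ℕ) : Matrix (Fin N) (Fin N) ℂ := gMat N ^ b * hMat N ^ a

lemma In_mod {N : ℕ} [NeZero N] (a b : ℕ) : In N (a % N) (b % N) = In N a b := by
  rw [In, In, ← pow_eq_pow_mod _ gMat_pow_N, ← pow_eq_pow_mod _ hMat_pow_N]

lemma In_mul {N : ℕ} [NeZero N] (a b c d : ℕ) :
    In N a b * In N c d = eπ (2 / N) ^ (a * d) • In N (a + c) (b + d) := by
  rw [In, In, In, mul_assoc, ← mul_assoc (hMat N ^ a), h_pow_g_pow, Matrix.smul_mul,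
    Matrix.mul_smul, pow_add, pow_add]
  simp only [mul_assoc]

lemma In_unit {N : ℕ} [NeZero N] (a b : ℕ) : IsUnit (In N a b).det := by
  rw [← Matrix.isUnit_iff_isUnit_det]
  exact ((IsUnit.of_pow_eq_one gMat_pow_N (NeZero.ne N)).pow b).mul
    ((IsUnit.of_pow_eq_one hMat_pow_N (NeZero.ne N)).pow a)

lemma In_kron {N : ℕ} [NeZero N] (a b c d : ℕ) :
    (In N (a + c) (b + d) * (In N a b)⁻¹) ⊗ₖ ((In N (a + c) (b + d))⁻¹ * In N a b) =
      chi N c d a b • (In N c d ⊗ₖ (In N c d)⁻¹) := by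
  have hw := eπ_ne (2 / N)
  have e1 : In N (a + c) (b + d) * (In N a b)⁻¹ = (eπ (2 / N) ^ (c * b))⁻¹ • In N c d := by
    have := In_mul (N := N) c d a b
    rw [add_comm c a, add_comm d b] at this
    rw [eq_inv_smul_iff₀ (pow_ne_zero _ hw), ← Matrix.smul_mul, ← this,
      Matrix.mul_nonsing_inv_cancel_right _ _ (In_unit a b)]
  have e2 : (In N (a + c) (b + d))⁻¹ * In N a b = eπ (2 / N) ^ (a * d) • (In N c d)⁻¹ := by
    have := In_mul (N := N) a b c d
    have h2 : In N a b = eπ (2 / N) ^ (a * d) • (In N (a + c) (b + d) * (In N c d)⁻¹) := by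
      rw [← Matrix.smul_mul, ← this, Matrix.mul_nonsing_inv_cancel_right _ _ (In_unit c d)]
    rw [h2, Matrix.mul_smul, Matrix.nonsing_inv_mul_cancel_left _ _ (In_unit _ _)]
  rw [e1, e2, Matrix.smul_kronecker, Matrix.kronecker_smul, smul_smul]
  congr 1
  rw [eπ, ← Complex.exp_nat_mul, ← Complex.exp_nat_mul, ← Complex.exp_neg, ← Complex.exp_add, chi]
  congr 1
  push_cast; ring

lemma Pflip_conj {N : ℕ} (M : Matrix (Fin N × Fin N) (Fin N × Fin N) ℂ) :
    Pflip N * M * Pflip N = M.submatrix (Equiv.prodComm _ _) (Equiv.prodComm _ _) := by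
  have h1 : ∀ M : Matrix (Fin N × Fin N) (Fin N × Fin N) ℂ, ∀ a b,
      (Pflip N * M) a b = M a.swap b := by
    intro M a b
    rw [Matrix.mul_apply, Finset.sum_eq_single a.swap]
    · simp [Pflip]
    · intro c _ hc
      have : ¬ (a.1 = c.2 ∧ a.2 = c.1) := fun h => hc (Prod.ext h.2.symm h.1.symm)
      simp [Pflip, this]
    · simp
  ext a b
  rw [Matrix.mul_apply, Finset.sum_eq_single b.swap]
  · rw [h1]; simp [Pflip]
  · intro c _ hc
    have : ¬ (c.1 = b.2 ∧ c.2 = b.1) := fun h => hc (Prod.ext h.1 h.2)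
    simp [Pflip, this]
  · simp

lemma kron_swap {N : ℕ} (A B : Matrix (Fin N) (Fin N) ℂ) :
    (A ⊗ₖ B).submatrix (Equiv.prodComm (Fin N) (Fin N)) (Equiv.prodComm (Fin N) (Fin N)) = B ⊗ₖ A := by
  ext a b
  simp [Matrix.kroneckerMap_apply, mul_comm]

lemma jTheta_sg (N j k : ℕ) (τ : ℂ) : ∃ C : ℂ, C ≠ 0 ∧ ∀ u,
    jTheta (1/2 + j / N) (1/2 + k / N) u τ = C * sg N τ j k u := by
  refine ⟨cexp (Real.pi * I * (j / N) ^ 2 * τ + 2 * Real.pi * I * (j / N) * (1 / 2 + k / N)),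
    Complex.exp_ne_zero _, fun u => ?_⟩
  rw [jTheta_th, sg, ← mul_assoc, ← Complex.exp_add]
  congr 2
  · push_cast; ring
  · push_cast; ring

lemma Wcoef_eq {N : ℕ} (α : Fin N × Fin N) (ξ ζ τ : ℂ) :
    Wcoef N α ξ ζ τ = (N:ℂ)⁻¹ * ww N τ (ζ / N) ξ α.1 α.2 := by
  obtain ⟨C, hC, h⟩ := jTheta_sg N α.1 α.2 τ
  rw [Wcoef, h, h, ww, add_comm ξ, mul_left_comm, mul_div_mul_left _ _ hC, div_mul_eq_div_div,
    div_right_comm, inv_mul_eq_div]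

lemma sum_W {N : ℕ} [NeZero N] {ξ ζ τ : ℂ} (hτ : 0 < τ.im)
    (hne : ∀ j < N, ∀ k < N, sg N τ j k (ζ / N) ≠ 0) :
    (∑ α : Fin N × Fin N, Wcoef N α ξ ζ τ • (Imat N α ⊗ₖ (Imat N α)⁻¹)) *
      (∑ α : Fin N × Fin N, Wcoef N α (-ξ) ζ τ • ((Imat N α)⁻¹ ⊗ₖ (Imat N α))) =
      (th τ (ζ + ξ) * th τ (ζ - ξ) / th τ ζ ^ 2) •
        (1 : Matrix (Fin N × Fin N) (Fin N × Fin N) ℂ) := by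
  have hN : 0 < N := NeZero.pos N
  have hN' : (N:ℂ) ≠ 0 := by exact_mod_cast hN.ne'
  have hI : ∀ α : Fin N × Fin N, Imat N α = In N α.1 α.2 := fun _ => rfl
  simp only [Wcoef_eq, hI]
  rw [Finset.sum_mul_sum, Finset.sum_comm]
  have step : ∀ β : Fin N × Fin N, ∑ α : Fin N × Fin N,
      (((N:ℂ)⁻¹ * ww N τ (ζ / N) ξ α.1 α.2) • (In N α.1 α.2 ⊗ₖ (In N α.1 α.2)⁻¹)) *
      (((N:ℂ)⁻¹ * ww N τ (ζ / N) (-ξ) β.1 β.2) • ((In N β.1 β.2)⁻¹ ⊗ₖ (In N β.1 β.2))) =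
      ∑ γ : Fin N × Fin N, ((N:ℂ)⁻¹ ^ 2 * (chi N γ.1 γ.2 β.1 β.2 *
        (ww N τ (ζ / N) ξ (β.1 + γ.1) (β.2 + γ.2) * ww N τ (ζ / N) (-ξ) β.1 β.2))) •
        (In N γ.1 γ.2 ⊗ₖ (In N γ.1 γ.2)⁻¹) := by
    intro β
    rw [← Equiv.sum_comp (Equiv.addLeft β)]
    refine Finset.sum_congr rfl fun γ _ => ?_
    simp only [Equiv.coe_addLeft, Prod.fst_add, Prod.snd_add, Fin.val_add, ww_mod hN', In_mod]
    rw [Matrix.smul_mul, Matrix.mul_smul, ← Matrix.mul_kronecker_mul, In_kron, smul_smul, smul_smul]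
    congr 1; ring
  rw [Finset.sum_congr rfl fun β _ => step β, Finset.sum_comm]
  simp only [← Finset.sum_smul, ← Finset.mul_sum]
  rw [Finset.sum_eq_single ((0, 0) : Fin N × Fin N)]
  · have hz : ((0 : Fin N) : ℕ) = 0 := Fin.val_eq_zero_iff.2 rfl
    simp only [hz, add_zero]
    have h1 : In N 0 0 = 1 := by simp [In]
    rw [h1, inv_one, Matrix.one_kronecker_one]
    congr 1
    have := sum_diag hN hτ hne ξ
    rw [mul_div_cancel₀ _ hN', Finset.sum_product, Finset.sum_range] at this
    simp only [Finset.sum_range] at this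
    rw [Fintype.sum_prod_type]
    have e : ∀ a b : ℕ, chi N 0 0 a b = 1 := by intro a b; simp [chi]
    simp only [e, one_mul, ww, ← sub_eq_add_neg]
    rw [this]
    field_simp
  · intro γ _ hγ
    rw [sum_off hτ hne ξ γ.1 γ.2 hγ, mul_zero, zero_smul]
  · simp

lemma kappa_neg (N : ℕ) (ξ ζ τ : ℂ) : kappaDen N (-ξ) ζ τ = kappaNum N ξ ζ τ := by
  rw [kappaDen, neg_neg]

lemma gHalf_unit (N : ℕ) : IsUnit (gHalf N ⊗ₖ gHalf N).det := by
  rw [isUnit_iff_ne_zero, Matrix.det_kronecker, gHalf, Matrix.det_diagonal]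
  have : (∏ i : Fin N, eπ ((((i : ℕ) : ℂ) + 1) / N)) ≠ 0 :=
    Finset.prod_ne_zero_iff.2 fun i _ => eπ_ne _
  exact mul_ne_zero (pow_ne_zero _ this) (pow_ne_zero _ this)

/-- The Belavin R-matrix is unitary: `R₁₂(z) R₂₁(z⁻¹) = Id`, where `z = eπ ξ`,
`z⁻¹ = eπ (-ξ)` and `R₂₁(w) = P R(w) P`. -/
theorem belavin_unitarity (N : ℕ) (hN : 2 ≤ N) (ξ ζ τ : ℂ)
    (hτ : 0 < τ.im) (hζ : 0 < ζ.im)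
    (h1 : Rgeneric N ξ ζ τ) (h2 : Rgeneric N (-ξ) ζ τ) :
    Rmat N ξ ζ τ * (Pflip N * Rmat N (-ξ) ζ τ * Pflip N) = 1 := by
  have hN0 : 0 < N := by omega
  have : NeZero N := ⟨hN0.ne'⟩
  have hN' : (N:ℂ) ≠ 0 := by exact_mod_cast hN0.ne'
  obtain ⟨h1a, h1b, h1c⟩ := h1
  obtain ⟨h2a, h2b, h2c⟩ := h2
  have hne : ∀ j < N, ∀ k < N, sg N τ j k (ζ / N) ≠ 0 := by
    intro j hj k hk
    obtain ⟨C, hC, h⟩ := jTheta_sg N j k τ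
    have := h1b (⟨j, hj⟩, ⟨k, hk⟩)
    rw [h] at this
    exact right_ne_zero_of_mul this
  obtain ⟨C, -, hζ0, -⟩ := exists_C hN0 hτ hne
  rw [mul_div_cancel₀ _ hN'] at hζ0
  have hZ : Zmat N ξ ζ τ *
      (Zmat N (-ξ) ζ τ).submatrix (Equiv.prodComm _ _) (Equiv.prodComm _ _) = 1 := by
    have hsw : (∑ α : Fin N × Fin N, Wcoef N α (-ξ) ζ τ • (Imat N α ⊗ₖ (Imat N α)⁻¹)).submatrix
        (Equiv.prodComm _ _) (Equiv.prodComm _ _) =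
        ∑ α : Fin N × Fin N, Wcoef N α (-ξ) ζ τ • ((Imat N α)⁻¹ ⊗ₖ (Imat N α)) := by
      ext a b
      rw [Matrix.submatrix_apply, Matrix.sum_apply, Matrix.sum_apply]
      refine Finset.sum_congr rfl fun α _ => ?_
      rw [← kron_swap, Matrix.smul_apply, Matrix.smul_apply, Matrix.submatrix_apply]
      rfl
    rw [Zmat, Zmat, Matrix.submatrix_smul, Pi.smul_apply, Pi.smul_apply, hsw, Matrix.smul_mul,
      Matrix.mul_smul, sum_W hτ hne, smul_smul, smul_smul, kappa_neg]
    rw [kappa_neg] at h2c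
    have hk : kappaNum N (-ξ) ζ τ = kappaDen N ξ ζ τ := rfl
    rw [hk]
    change th τ (ξ + ζ) ≠ 0 at h1a
    change th τ (-ξ + ζ) ≠ 0 at h2a
    convert one_smul ℂ (1 : Matrix (Fin N × Fin N) (Fin N × Fin N) ℂ)
    change eπ (ξ * (2 / N - 2)) * (kappaNum N ξ ζ τ / kappaDen N ξ ζ τ) *
      th τ ζ / th τ (ξ + ζ) * (eπ (-ξ * (2 / N - 2)) * (kappaDen N ξ ζ τ / kappaNum N ξ ζ τ) *
      th τ ζ / th τ (-ξ + ζ)) * (th τ (ζ + ξ) * th τ (ζ - ξ) / th τ ζ ^ 2) = 1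
    have he : eπ (ξ * (2 / N - 2)) * eπ (-ξ * (2 / N - 2)) = 1 := by
      rw [← eπ_add, show ξ * (2 / N - 2) + -ξ * (2 / (N:ℂ) - 2) = 0 by ring, eπ]; simp
    rw [show ζ + ξ = ξ + ζ by ring, show ζ - ξ = -ξ + ζ by ring]
    generalize eπ (ξ * (2 / N - 2)) = A at *
    generalize eπ (-ξ * (2 / N - 2)) = B at *
    field_simp
    exact he
  have hU := gHalf_unit N
  rw [Pflip_conj, Rmat, Rmat]
  rw [← Matrix.submatrix_mul_equiv _ _ _ (Equiv.prodComm (Fin N) (Fin N)),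
    ← Matrix.submatrix_mul_equiv _ _ _ (Equiv.prodComm (Fin N) (Fin N)),
    ← Matrix.inv_submatrix_equiv, kron_swap]
  generalize gHalf N ⊗ₖ gHalf N = K at *
  rw [mul_assoc (K * _), ← mul_assoc K⁻¹, ← mul_assoc K⁻¹, Matrix.nonsing_inv_mul _ hU, one_mul,
    mul_assoc K, ← mul_assoc (Zmat N ξ ζ τ), hZ, one_mul, Matrix.mul_nonsing_inv _ hU]

end
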